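/- For every smooth function f ∈ C^∞(𝕋²) and all 0 < r ≤ R, ∫_{𝕋²} ∫_{B_R \ B_r} |f(x+z) − f(x)|²/|z|³ dz dx ≤ 8 log(R/r) · ‖f‖_∞ · ∫_{𝕋²} |∇f| dx, where B_ρ ⊂ ℝ² is the open ball of radius ρ centered at 0 and ‖f‖_∞ is the supremum norm of f. -/

import Mathlib

open MeasureTheory Real

noncomputable section

/-- The plane `ℝ²`, modeled as functions `Fin 2 → ℝ`. -/
abbrev R2 : Type := Fin 2 → ℝ

/-- A fundamental domain for the unit torus `𝕋² = ℝ²/ℤ²`. -/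
def cube : Set R2 := Set.univ.pi fun _ => Set.Ico (0 : ℝ) 1

/-- `ℤ²`-periodicity: functions on the torus `𝕋²`. -/
def Per (f : R2 → ℝ) : Prop :=
  ∀ (x : R2) (n : Fin 2 → ℤ), f (x + fun i => (n i : ℝ)) = f x

/-- The Euclidean norm on `ℝ²`. -/
def en2 (z : R2) : ℝ := Real.sqrt (∑ i, z i ^ 2)

/-- `|∇f(x)|²`, the squared Euclidean norm of the gradient. -/
def gradNormSq (f : R2 → ℝ) (x : R2) : ℝ :=
  ∑ j, (fderiv ℝ f x (Pi.single j 1)) ^ 2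

/-- `|∇f(x)|`, the Euclidean norm of the gradient. -/
def gradNorm (f : R2 → ℝ) (x : R2) : ℝ := Real.sqrt (gradNormSq f x)

/-- The supremum norm `‖f‖_∞`. -/
def supNorm (f : R2 → ℝ) : ℝ := ⨆ x : R2, |f x|

/-- The squared homogeneous `H^{1/2}` seminorm on the torus (real-space formula). -/
def H12 (f : R2 → ℝ) : ℝ :=
  (1 / (4 * π)) * ∫ x in cube, ∫ z : R2, (f (x + z) - f x) ^ 2 / en2 z ^ 3

lemma aux_abs_cos : ∫ x in (-π)..π, |Real.cos x| = 4 := by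
  have hp : Function.Periodic (fun x : ℝ => |Real.cos x|) π := by
    intro x
    simp [Real.cos_add_pi]
  have hc : Continuous (fun x : ℝ => |Real.cos x|) := by fun_prop
  have hi : ∀ a b : ℝ, IntervalIntegrable (fun x : ℝ => |Real.cos x|) volume a b :=
    fun a b => hc.intervalIntegrable a b
  have h0 : ∫ x in (-(π/2))..(-(π/2) + π), |Real.cos x| = 2 := by
    have : ∫ x in (-(π/2))..(-(π/2) + π), |Real.cos x|
        = ∫ x in (-(π/2))..(-(π/2) + π), Real.cos x := by
      apply intervalIntegral.integral_congr
      intro x hx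
      rw [Set.uIcc_of_le (by linarith [Real.pi_pos])] at hx
      exact abs_of_nonneg (Real.cos_nonneg_of_mem_Icc ⟨hx.1, by linarith [hx.2]⟩)
    rw [this, integral_cos]
    have : -(π/2) + π = π/2 := by ring
    rw [this, Real.sin_neg, Real.sin_pi_div_two]
    norm_num
  have h1 := hp.intervalIntegral_add_eq (-π) (-(π/2))
  have h2 := hp.intervalIntegral_add_eq 0 (-(π/2))
  rw [← intervalIntegral.integral_add_adjacent_intervals (hi (-π) 0) (hi 0 π)]
  simp only [neg_add_cancel, zero_add] at h1 h2
  rw [h1, h2, h0]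
  norm_num

lemma aux_angle (a b : ℝ) :
    ∫ x in (-π)..π, |a * Real.cos x + b * Real.sin x| = 4 * Real.sqrt (a ^ 2 + b ^ 2) := by
  set w : ℂ := ⟨a, b⟩ with hw
  have hn : ‖w‖ = Real.sqrt (a ^ 2 + b ^ 2) := by
    rw [Complex.norm_def, Complex.normSq_apply]; congr 1; simp [hw]; ring
  have ha : a = ‖w‖ * Real.cos w.arg := by rw [Complex.norm_mul_cos_arg]
  have hb : b = ‖w‖ * Real.sin w.arg := by rw [Complex.norm_mul_sin_arg]
  have : ∀ x : ℝ, |a * Real.cos x + b * Real.sin x| = ‖w‖ * |Real.cos (x - w.arg)| := by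
    intro x
    rw [Real.cos_sub, ← abs_of_nonneg (norm_nonneg w), ← abs_mul]
    congr 1
    conv_lhs => rw [ha, hb]
    ring
  simp_rw [this]
  rw [intervalIntegral.integral_const_mul,
    intervalIntegral.integral_comp_sub_right (fun x => |Real.cos x|), hn]
  have hp : Function.Periodic (fun x : ℝ => |Real.cos x|) (2 * π) := by
    intro x
    simp
  have h1 := hp.intervalIntegral_add_eq (-π - w.arg) (-π)
  have e1 : -π - w.arg + 2 * π = π - w.arg := by ring
  have e2 : -π + 2 * π = π := by ring
  rw [e1, e2, aux_abs_cos] at h1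
  rw [h1, mul_comm]

lemma aux_en2 (z : R2) : en2 z = Real.sqrt (z 0 ^ 2 + z 1 ^ 2) := by
  simp [en2, Fin.sum_univ_two]

lemma aux_en2_cont : Continuous en2 := by
  unfold en2; fun_prop

lemma aux_meas (r R : ℝ) : MeasurableSet ({z : R2 | en2 z < R} \ {z : R2 | en2 z < r}) :=
  (measurableSet_lt aux_en2_cont.measurable measurable_const).diff
    (measurableSet_lt aux_en2_cont.measurable measurable_const)

lemma aux_polar (a b r R : ℝ) (hr : 0 < r) (hrR : r ≤ R) :
    ∫ z in {z : R2 | en2 z < R} \ {z : R2 | en2 z < r}, |a * z 0 + b * z 1| / en2 z ^ 3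
      = 4 * Real.log (R / r) * Real.sqrt (a ^ 2 + b ^ 2) := by
  rw [← integral_indicator (aux_meas r R)]
  rw [← (volume_preserving_finTwoArrow ℝ).symm.integral_comp
    (MeasurableEquiv.measurableEmbedding _), ← integral_comp_polarCoord_symm]
  have key : ∀ p ∈ polarCoord.target,
      p.1 • ({z : R2 | en2 z < R} \ {z : R2 | en2 z < r}).indicator
        (fun z => |a * z 0 + b * z 1| / en2 z ^ 3)
        (MeasurableEquiv.finTwoArrow.symm (polarCoord.symm p))
      = (Set.Ico r R).indicator (fun x => x⁻¹) p.1
        * |a * Real.cos p.2 + b * Real.sin p.2| := by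
    rintro ⟨ρ, θ⟩ hp
    have hρ : 0 < ρ := hp.1
    set z : R2 := MeasurableEquiv.finTwoArrow.symm (polarCoord.symm (ρ, θ)) with hz
    have z0 : z 0 = ρ * Real.cos θ := rfl
    have z1 : z 1 = ρ * Real.sin θ := rfl
    have hen : en2 z = ρ := by
      rw [aux_en2, z0, z1]
      rw [show (ρ * Real.cos θ) ^ 2 + (ρ * Real.sin θ) ^ 2
        = ρ ^ 2 * (Real.sin θ ^ 2 + Real.cos θ ^ 2) by ring, Real.sin_sq_add_cos_sq, mul_one,
        Real.sqrt_sq hρ.le]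
    by_cases h : ρ ∈ Set.Ico r R
    · have h' : z ∈ ({z : R2 | en2 z < R} \ {z : R2 | en2 z < r}) := by
        refine ⟨?_, ?_⟩
        · show en2 z < R
          rw [hen]; exact h.2
        · show ¬ (en2 z < r)
          rw [hen]; exact not_lt.2 h.1
      rw [Set.indicator_of_mem h', Set.indicator_of_mem h, hen, z0, z1]
      rw [show a * (ρ * Real.cos θ) + b * (ρ * Real.sin θ)
        = ρ * (a * Real.cos θ + b * Real.sin θ) by ring, abs_mul, abs_of_pos hρ, smul_eq_mul]
      field_simp
    · have h' : z ∉ ({z : R2 | en2 z < R} \ {z : R2 | en2 z < r}) := by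
        rintro ⟨h1, h2⟩
        have h1 : en2 z < R := h1
        have h2 : ¬ (en2 z < r) := h2
        rw [hen] at h1 h2
        exact h ⟨not_lt.1 h2, h1⟩
      rw [Set.indicator_of_notMem h', Set.indicator_of_notMem h]
      simp
  rw [setIntegral_congr_fun polarCoord.open_target.measurableSet key]
  rw [polarCoord_target, Measure.volume_eq_prod,
    setIntegral_prod_mul ((Set.Ico r R).indicator (fun x => x⁻¹))
      (fun x => |a * Real.cos x + b * Real.sin x|)]
  rw [setIntegral_indicator measurableSet_Ico]
  have : Set.Ioi 0 ∩ Set.Ico r R = Set.Ico r R :=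
    Set.inter_eq_right.2 fun x hx => lt_of_lt_of_le hr hx.1
  rw [this, integral_Ico_eq_integral_Ioo, ← integral_Ioc_eq_integral_Ioo,
    ← integral_Ioc_eq_integral_Ioo,
    ← intervalIntegral.integral_of_le hrR, ← intervalIntegral.integral_of_le (by linarith [pi_pos]),
    aux_angle, integral_inv_of_pos hr (hr.trans_le hrR)]
  ring

lemma aux_fund : IsAddFundamentalDomain
    (Submodule.span ℤ (Set.range (Pi.basisFun ℝ (Fin 2)))).toAddSubgroup
    cube volume := by
  have := ZSpan.isAddFundamentalDomain' (Pi.basisFun ℝ (Fin 2)) volume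
  rwa [ZSpan.fundamentalDomain_pi_basisFun] at this

open scoped Pointwise in
lemma aux_trans (g : R2 → ℝ) (hg : Per g) (v : R2) :
    ∫ x in cube, g (x + v) = ∫ x in cube, g x := by
  have h2 := aux_fund.vadd_of_comm v
  have hinv : ∀ (l : (Submodule.span ℤ (Set.range (Pi.basisFun ℝ (Fin 2)))).toAddSubgroup) (x : R2),
      g (l +ᵥ x) = g x := by
    intro l x
    have hl : (l : R2) ∈ Submodule.span ℤ (Set.range (Pi.basisFun ℝ (Fin 2))) := l.2
    rw [Submodule.mem_span_range_iff_exists_fun] at hl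
    obtain ⟨c, hc⟩ := hl
    rw [← hg x c, AddSubgroup.vadd_def, ← hc, vadd_eq_add, add_comm]
    congr 2
    ext i
    fin_cases i <;> simp [Pi.single_apply]
  have : Countable (Submodule.span ℤ (Set.range (Pi.basisFun ℝ (Fin 2)))).toAddSubgroup :=
    inferInstanceAs (Countable (Submodule.span ℤ (Set.range (Pi.basisFun ℝ (Fin 2)))))
  rw [aux_fund.setIntegral_eq h2 hinv]
  have h3 := (measurePreserving_vadd v (volume : Measure R2)).setIntegral_preimage_emb
    (MeasurableEquiv.vadd v).measurableEmbedding g (v +ᵥ cube)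
  have h4 : (fun x : R2 => v +ᵥ x) ⁻¹' (v +ᵥ cube) = cube :=
    Set.preimage_image_eq _ (add_right_injective v)
  rw [h4] at h3
  rw [← h3]
  simp [add_comm]

lemma aux_cube_sub : cube ⊆ Set.Icc (0 : R2) 1 := by
  intro x hx
  exact ⟨fun i => (hx i trivial).1, fun i => (hx i trivial).2.le⟩

lemma aux_cube_meas : MeasurableSet cube :=
  MeasurableSet.univ_pi fun _ => measurableSet_Ico

lemma aux_bdd (f : R2 → ℝ) (hf : Continuous f) (hper : Per f) (x : R2) : |f x| ≤ supNorm f := by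
  have hb : BddAbove ((fun x => |f x|) '' Set.Icc (0 : R2) 1) :=
    (isCompact_Icc.image hf.abs).bddAbove
  refine le_ciSup (f := fun x => |f x|) ?_ x
  obtain ⟨M, hM⟩ := hb
  refine ⟨M, ?_⟩
  rintro _ ⟨y, rfl⟩
  show |f y| ≤ M
  rw [← hper y fun i => -⌊y i⌋]
  refine hM ⟨_, ⟨fun i => ?_, fun i => ?_⟩, rfl⟩
  · simpa using Int.floor_le (y i)
  · have := (Int.fract_lt_one (y i)).le
    simp only [Int.fract] at this
    simp
    linarith

lemma aux_int {X Y : Type*} [TopologicalSpace X] [TopologicalSpace Y] [MeasureSpace X]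
    [MeasureSpace Y] [SecondCountableTopology X] [T2Space X] [T2Space Y]
    [OpensMeasurableSpace X] [OpensMeasurableSpace Y]
    [SecondCountableTopology Y]
    [IsFiniteMeasureOnCompacts (volume : Measure X)]
    [IsFiniteMeasureOnCompacts (volume : Measure Y)] [SFinite (volume : Measure X)]
    [SFinite (volume : Measure Y)] (s K : Set X) (t L : Set Y) (hs : s ⊆ K) (ht : t ⊆ L)
    (hK : IsCompact K) (hL : IsCompact L) (F : X × Y → ℝ) (hF : ContinuousOn F (K ×ˢ L)) :
    Integrable F (((volume : Measure X).restrict s).prod ((volume : Measure Y).restrict t)) := by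
  have : IntegrableOn F (K ×ˢ L) ((volume : Measure X).prod volume) := by
    exact hF.integrableOn_compact (hK.prod hL)
  rw [Measure.prod_restrict]
  exact this.mono_set (Set.prod_mono hs ht)

lemma aux_compact (r R : ℝ) : IsCompact {z : R2 | r ≤ en2 z ∧ en2 z ≤ R} := by
  refine IsCompact.of_isClosed_subset (isCompact_Icc (a := (fun _ => -R : R2)) (b := fun _ => R))
    ?_ ?_
  · exact (isClosed_le continuous_const aux_en2_cont).inter
      (isClosed_le aux_en2_cont continuous_const)
  · rintro z ⟨-, h⟩
    have : ∀ i, |z i| ≤ R := by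
      intro i
      refine le_trans ?_ h
      rw [← Real.sqrt_sq_eq_abs]
      apply Real.sqrt_le_sqrt
      exact Finset.single_le_sum (f := fun i => z i ^ 2) (fun i _ => sq_nonneg _)
        (Finset.mem_univ i)
    exact ⟨fun i => (abs_le.1 (this i)).1, fun i => (abs_le.1 (this i)).2⟩

lemma aux_fderiv_per (f : R2 → ℝ) (hper : Per f) (x : R2) (n : Fin 2 → ℤ) :
    fderiv ℝ f (x + fun i => (n i : ℝ)) = fderiv ℝ f x := by
  rw [← fderiv_comp_add_right]
  congr 1
  ext y
  exact hper y n

lemma aux_L1 (f : R2 → ℝ) (hf : ContDiff ℝ (⊤ : ℕ∞) f) (hper : Per f) (z : R2) :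
    ∫ x in cube, |f (x + z) - f x| ≤ ∫ x in cube, |fderiv ℝ f x z| := by
  have hD : Continuous (fderiv ℝ f) := hf.continuous_fderiv (by simp)
  have hfc := hf.continuous
  have hdiff : Differentiable ℝ f := hf.differentiable (by simp)
  have hpt : ∀ x, |f (x + z) - f x| ≤ ∫ t in (0:ℝ)..1, |fderiv ℝ f (x + t • z) z| := by
    intro x
    have hc : Continuous fun t : ℝ => fderiv ℝ f (x + t • z) z := by fun_prop
    have h1 : ∫ t in (0:ℝ)..1, fderiv ℝ f (x + t • z) z = f (x + z) - f x := by
      have := intervalIntegral.integral_eq_sub_of_hasDerivAt (a := 0) (b := 1)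
        (f := fun t : ℝ => f (x + t • z)) (f' := fun t : ℝ => fderiv ℝ f (x + t • z) z)
        (fun t _ => by
          have hl : HasDerivAt (fun t : ℝ => x + t • z) z t := by
            simpa using ((hasDerivAt_id t).smul_const z).const_add x
          exact (hdiff (x + t • z)).hasFDerivAt.comp_hasDerivAt t hl)
        (hc.intervalIntegrable _ _)
      simpa using this
    rw [← h1]
    exact intervalIntegral.abs_integral_le_integral_abs zero_le_one
  have hint : Integrable (Function.uncurry fun (t : ℝ) (x : R2) => |fderiv ℝ f (x + t • z) z|)
      ((volume.restrict (Set.uIoc 0 1)).prod (volume.restrict cube)) := by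
    refine aux_int _ (Set.uIcc 0 1) _ (Set.Icc (0 : R2) 1) Set.uIoc_subset_uIcc aux_cube_sub
      isCompact_uIcc isCompact_Icc _ ?_
    apply Continuous.continuousOn
    unfold Function.uncurry
    fun_prop
  calc ∫ x in cube, |f (x + z) - f x|
      ≤ ∫ x in cube, ∫ t in (0:ℝ)..1, |fderiv ℝ f (x + t • z) z| := by
        apply integral_mono
        · have : Continuous fun x => |f (x + z) - f x| := by fun_prop
          exact (this.continuousOn.integrableOn_compact isCompact_Icc).mono_set aux_cube_sub
        · have := hint.integral_prod_right
          simpa only [intervalIntegral.intervalIntegral_eq_integral_uIoc, Function.uncurry,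
            zero_le_one, if_true, one_smul] using this
        · exact hpt
    _ = ∫ t in (0:ℝ)..1, ∫ x in cube, |fderiv ℝ f (x + t • z) z| :=
        (intervalIntegral_integral_swap hint).symm
    _ = ∫ t in (0:ℝ)..1, ∫ x in cube, |fderiv ℝ f x z| := by
        congr 1
        ext t
        exact aux_trans (fun x => |fderiv ℝ f x z|)
          (fun x n => by simp only [aux_fderiv_per f hper]) (t • z)
    _ = ∫ x in cube, |fderiv ℝ f x z| := by simp

/-- intermediate-scale estimate on the annulus `B_R \ B_r`. -/
theorem stmt_2 (f : R2 → ℝ) (hf : ContDiff ℝ (⊤ : ℕ∞) f) (hper : Per f)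
    (r R : ℝ) (hr : 0 < r) (hrR : r ≤ R) :
    (∫ x in cube, ∫ z in {z : R2 | en2 z < R} \ {z : R2 | en2 z < r},
        (f (x + z) - f x) ^ 2 / en2 z ^ 3)
      ≤ 8 * Real.log (R / r) * supNorm f * ∫ x in cube, gradNorm f x := by
  have hD : Continuous (fderiv ℝ f) := hf.continuous_fderiv (by simp)
  have hfc := hf.continuous
  set A : Set R2 := {z : R2 | en2 z < R} \ {z : R2 | en2 z < r} with hA
  have hAm : MeasurableSet A := aux_meas r R
  have hAsub : A ⊆ {z : R2 | r ≤ en2 z ∧ en2 z ≤ R} :=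
    fun z hz => ⟨not_lt.1 hz.2, le_of_lt hz.1⟩
  have hen := aux_en2_cont
  have hne : ∀ p ∈ Set.Icc (0 : R2) 1 ×ˢ {z : R2 | r ≤ en2 z ∧ en2 z ≤ R}, en2 p.2 ^ 3 ≠ 0 := by
    intro p hp
    have : 0 < en2 p.2 := hr.trans_le hp.2.1
    positivity
  have hS0 : 0 ≤ supNorm f := (abs_nonneg _).trans (aux_bdd f hfc hper 0)
  have hi1 : Integrable (Function.uncurry fun (x z : R2) => (f (x + z) - f x) ^ 2 / en2 z ^ 3)
      ((volume.restrict cube).prod (volume.restrict A)) := by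
    refine aux_int _ _ _ _ aux_cube_sub hAsub isCompact_Icc (aux_compact r R) _ ?_
    unfold Function.uncurry
    exact ContinuousOn.div (by fun_prop) (by fun_prop) hne
  have hi2 : Integrable (Function.uncurry fun (x z : R2) => |fderiv ℝ f x z| / en2 z ^ 3)
      ((volume.restrict cube).prod (volume.restrict A)) := by
    refine aux_int _ _ _ _ aux_cube_sub hAsub isCompact_Icc (aux_compact r R) _ ?_
    unfold Function.uncurry
    exact ContinuousOn.div (by fun_prop) (by fun_prop) hne
  have hz : ∀ z ∈ A, ∫ x in cube, (f (x + z) - f x) ^ 2 / en2 z ^ 3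
      ≤ 2 * supNorm f * ∫ x in cube, |fderiv ℝ f x z| / en2 z ^ 3 := by
    intro z hz
    have hpos : 0 < en2 z := hr.trans_le (hAsub hz).1
    rw [integral_div, integral_div, ← mul_div_assoc]
    gcongr
    calc ∫ x in cube, (f (x + z) - f x) ^ 2
        ≤ ∫ x in cube, 2 * supNorm f * |f (x + z) - f x| := by
          apply integral_mono
          · have : Continuous fun x => (f (x + z) - f x) ^ 2 := by fun_prop
            exact (this.continuousOn.integrableOn_compact isCompact_Icc).mono_set aux_cube_sub
          · have : Continuous fun x => 2 * supNorm f * |f (x + z) - f x| := by fun_prop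
            exact (this.continuousOn.integrableOn_compact isCompact_Icc).mono_set aux_cube_sub
          · intro x
            show (f (x + z) - f x) ^ 2 ≤ 2 * supNorm f * |f (x + z) - f x|
            rw [← sq_abs, sq]
            apply mul_le_mul_of_nonneg_right _ (abs_nonneg _)
            have h1 := aux_bdd f hfc hper (x + z)
            have h2 := aux_bdd f hfc hper x
            have h3 := abs_sub (f (x + z)) (f x)
            linarith
      _ = 2 * supNorm f * ∫ x in cube, |f (x + z) - f x| := integral_const_mul _ _
      _ ≤ _ := by
          apply mul_le_mul_of_nonneg_left (aux_L1 f hf hper z) (by positivity)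
  have hx : ∀ x, ∫ z in A, |fderiv ℝ f x z| / en2 z ^ 3
      = 4 * Real.log (R / r) * gradNorm f x := by
    intro x
    have := aux_polar (fderiv ℝ f x (Pi.single 0 1)) (fderiv ℝ f x (Pi.single 1 1)) r R hr hrR
    rw [gradNorm, gradNormSq, Fin.sum_univ_two, ← this]
    congr 1
    ext z
    have hzz : z = z 0 • (Pi.single 0 1 : R2) + z 1 • (Pi.single 1 1 : R2) := by
      ext i
      fin_cases i <;> simp
    have : fderiv ℝ f x z
        = fderiv ℝ f x (Pi.single 0 1) * z 0 + fderiv ℝ f x (Pi.single 1 1) * z 1 := by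
      conv_lhs => rw [hzz]
      rw [map_add, map_smul, map_smul]
      simp [mul_comm]
    rw [this]
  calc ∫ x in cube, ∫ z in A, (f (x + z) - f x) ^ 2 / en2 z ^ 3
      = ∫ z in A, ∫ x in cube, (f (x + z) - f x) ^ 2 / en2 z ^ 3 := integral_integral_swap hi1
    _ ≤ ∫ z in A, 2 * supNorm f * ∫ x in cube, |fderiv ℝ f x z| / en2 z ^ 3 := by
        refine setIntegral_mono_on ?_ ?_ hAm hz
        · exact hi1.integral_prod_right
        · exact hi2.integral_prod_right.const_mul _
    _ = 2 * supNorm f * ∫ x in cube, ∫ z in A, |fderiv ℝ f x z| / en2 z ^ 3 := by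
        rw [integral_const_mul, integral_integral_swap hi2]
    _ = 2 * supNorm f * ∫ x in cube, 4 * Real.log (R / r) * gradNorm f x := by
        simp_rw [hx]
    _ = _ := by
        rw [integral_const_mul]; ring
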